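/- Bound on the z-frequency coupling term. Let m > 1 and 0 < δ ≤ 1/2. For any ζ ∈ ℝ, τ ∈ ℝ, and w = (w^ξ, w^z) ∈ L²_ξ(m) (with w^ξ ℝ²-valued and w^z scalar), the coupling term Z(w) = (Z^ξ(w), Z^z(w)) defined by Z^ξ(w) = i e^{τ/2} ζ G [ i e^{τ/2} ζ (e^τ|ζ|² − Δ_ξ)^{−1}(w^ξ)^⊥ − ∇_ξ^⊥(e^τ|ζ|² − Δ_ξ)^{−1} w^z ] and Z^z(w) = i e^{τ/2} ζ ∇_ξ^⊥ · ( G (e^τ|ζ|² − Δ_ξ)^{−1} w^ξ ) + ∇_ξ G · ( (e^τ|ζ|² − Δ_ξ)^{−1} − (−Δ_ξ)^{−1} ) ∇_ξ^⊥ w^z satisfies ‖Z(w)‖_{L²_ξ(m)} ≲_{δ,m} |ζ|^{1−2δ} e^{(1/2−δ)τ} ‖w‖_{L²_ξ(m)}. -/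

import Mathlib

/-!
Bound on the z-frequency coupling term `Z(w)` (Corollary on the perturbative
term in the linearization around the Oseen vortex, fixed frequency `ζ`).
-/

open MeasureTheory Real Set
open scoped ENNReal

noncomputable section

abbrev R2 : Type := EuclideanSpace ℝ (Fin 2)
abbrev C2 : Type := EuclideanSpace ℂ (Fin 2)
abbrev C3 : Type := EuclideanSpace ℂ (Fin 3)

def v2 (a b : ℝ) : R2 := (WithLp.equiv 2 (Fin 2 → ℝ)).symm ![a, b]
def cv2 (a b : ℂ) : C2 := (WithLp.equiv 2 (Fin 2 → ℂ)).symm ![a, b]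
def cv3 (a b c : ℂ) : C3 := (WithLp.equiv 2 (Fin 3 → ℂ)).symm ![a, b, c]

def perp (x : R2) : R2 := v2 (-(x 1)) (x 0)

def Gval (ξ : R2) : ℝ := (4 * π)⁻¹ * Real.exp (-‖ξ‖^2/4)

/-- kernel of `(a − Δ)⁻¹` on ℝ² via subordination to the heat kernel. -/
def resKer (a : ℝ) (x : R2) : ℝ :=
  ∫ t in Ioi (0:ℝ), Real.exp (-(a*t)) * ((4 * π * t)⁻¹ * Real.exp (-‖x‖^2/(4*t)))

/-- scalar radial factor of `∇` of the above kernel: `∇K_a(x) = resGradScalar a x • x`. -/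
def resGradScalar (a : ℝ) (x : R2) : ℝ :=
  ∫ t in Ioi (0:ℝ),
    Real.exp (-(a*t)) * ((4 * π * t)⁻¹ * Real.exp (-‖x‖^2/(4*t))) * (-(2*t)⁻¹)

/-- scalar radial factor of the kernel of `∇(−Δ)⁻¹`: kernel `= −(1/2π) x/|x|²`. -/
def newtonGradScalar (x : R2) : ℝ := -(2 * π)⁻¹ * ‖x‖^(-(2:ℝ))

/-- `(a − Δ)⁻¹` on complex scalar functions. -/
def resConv (a : ℝ) (f : R2 → ℂ) (ξ : R2) : ℂ :=
  ∫ η : R2, (resKer a (ξ - η) : ℂ) * f η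

/-- `(a − Δ)⁻¹` applied componentwise to a complex 2-vector field. -/
def resConv2 (a : ℝ) (w : R2 → C2) (ξ : R2) : C2 :=
  cv2 (resConv a (fun η => w η 0) ξ) (resConv a (fun η => w η 1) ξ)

/-- `∇^⊥ (a − Δ)⁻¹ f`. -/
def resGradPerp (a : ℝ) (f : R2 → ℂ) (ξ : R2) : C2 :=
  ∫ η : R2, (f η * (resGradScalar a (ξ - η) : ℂ)) •
    cv2 ((perp (ξ - η) 0 : ℝ) : ℂ) ((perp (ξ - η) 1 : ℝ) : ℂ)

/-- `((a − Δ)⁻¹ − (−Δ)⁻¹) ∇^⊥ f`. -/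
def resMinusNewtonGradPerp (a : ℝ) (f : R2 → ℂ) (ξ : R2) : C2 :=
  ∫ η : R2, (f η * ((resGradScalar a (ξ - η) - newtonGradScalar (ξ - η) : ℝ) : ℂ)) •
    cv2 ((perp (ξ - η) 0 : ℝ) : ℂ) ((perp (ξ - η) 1 : ℝ) : ℂ)

/-- `∇^⊥ · ((a − Δ)⁻¹ w)` for a complex 2-vector field `w`. -/
def resGradPerpDiv (a : ℝ) (w : R2 → C2) (ξ : R2) : ℂ :=
  ∫ η : R2, (resGradScalar a (ξ - η) : ℂ) *
    ((perp (ξ - η) 0 : ℂ) * w η 0 + (perp (ξ - η) 1 : ℂ) * w η 1)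

/-- `Z^ξ(w) = i e^{τ/2} ζ G [ i e^{τ/2} ζ (e^τζ²−Δ)⁻¹ (w^ξ)^⊥ − ∇^⊥(e^τζ²−Δ)⁻¹ w^z ]`. -/
def Zxi (τ ζ : ℝ) (w1 : R2 → C2) (w2 : R2 → ℂ) (ξ : R2) : C2 :=
  (Complex.I * (Real.exp (τ/2) * ζ : ℝ) * (Gval ξ : ℝ)) •
    ((Complex.I * (Real.exp (τ/2) * ζ : ℝ)) •
        resConv2 (Real.exp τ * ζ^2) (fun η => cv2 (-(w1 η 1)) (w1 η 0)) ξ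
      - resGradPerp (Real.exp τ * ζ^2) w2 ξ)

/-- `Z^z(w) = i e^{τ/2} ζ ∇^⊥·(G (e^τζ²−Δ)⁻¹ w^ξ)
      + ∇G · ((e^τζ²−Δ)⁻¹ − (−Δ)⁻¹) ∇^⊥ w^z`,
with `∇G(ξ) = −(ξ/2) G(ξ)` and `∇^⊥·(GV) = ∇^⊥G·V + G ∇^⊥·V`. -/
def Zz (τ ζ : ℝ) (w1 : R2 → C2) (w2 : R2 → ℂ) (ξ : R2) : ℂ :=
  Complex.I * (Real.exp (τ/2) * ζ : ℝ) *
    ( ((-(perp ξ 0)/2 * Gval ξ : ℝ) : ℂ) * resConv2 (Real.exp τ * ζ^2) w1 ξ 0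
      + ((-(perp ξ 1)/2 * Gval ξ : ℝ) : ℂ) * resConv2 (Real.exp τ * ζ^2) w1 ξ 1
      + (Gval ξ : ℂ) * resGradPerpDiv (Real.exp τ * ζ^2) w1 ξ )
  + ( ((-(ξ 0)/2 * Gval ξ : ℝ) : ℂ) * resMinusNewtonGradPerp (Real.exp τ * ζ^2) w2 ξ 0
      + ((-(ξ 1)/2 * Gval ξ : ℝ) : ℂ) * resMinusNewtonGradPerp (Real.exp τ * ζ^2) w2 ξ 1 )

/-- weighted `L²_ξ(m)` norm of a complex 3-vector field. -/
def L2mC (m : ℝ) (F : R2 → C3) : ℝ≥0∞ :=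
  eLpNorm (fun ξ : R2 => ((1 + ‖ξ‖^2) ^ (m/2) : ℝ) • F ξ) 2 volume

lemma min_one_inv_le_rpow {t θ : ℝ} (ht : 0 < t) (h0 : 0 ≤ θ) (h1 : θ ≤ 1) :
    min 1 t⁻¹ ≤ t ^ (-θ) := by
  rcases le_total t 1 with h | h
  · exact (min_le_left _ _).trans (Real.one_le_rpow_of_pos_of_le_one_of_nonpos ht h (by linarith))
  · refine (min_le_right _ _).trans ?_
    rw [← Real.rpow_neg_one]
    exact Real.rpow_le_rpow_of_exponent_le h (by linarith)

lemma one_sub_exp_neg_le_rpow {y θ : ℝ} (hy : 0 < y) (h0 : 0 ≤ θ) (h1 : θ ≤ 1) :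
    1 - Real.exp (-y) ≤ y ^ θ := by
  rcases le_total y 1 with h | h
  · have := Real.add_one_le_exp (-y)
    have h2 := Real.rpow_le_rpow_of_exponent_ge hy h h1
    rw [Real.rpow_one] at h2
    linarith
  · have := Real.exp_pos (-y)
    have := Real.one_le_rpow h h0
    linarith

lemma inv_sqrt_eq_rpow (t : ℝ) (ht : 0 ≤ t) : (√t)⁻¹ = t ^ (-(1 / 2) : ℝ) := by
  rw [Real.sqrt_eq_rpow, Real.rpow_neg ht]

/-- A common weight in the heat time `t` that dominates, up to the factor
`t⁻¹ exp (-|x|²/(8 t))`, the subordination integrands of all kernels in `Z`. -/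
def timeWeight (b t : ℝ) : ℝ :=
  Real.exp (-(b ^ 2 * t)) * (b ^ 2 + b + b * (√t)⁻¹) + (1 - Real.exp (-(b ^ 2 * t))) * (√t)⁻¹

lemma measurable_timeWeight (b : ℝ) : Measurable (timeWeight b) := by
  unfold timeWeight; fun_prop

lemma one_sub_exp_nonneg {b t : ℝ} (ht : 0 < t) : 0 ≤ 1 - Real.exp (-(b ^ 2 * t)) := by
  have : Real.exp (-(b ^ 2 * t)) ≤ 1 := Real.exp_le_one_iff.2 (by nlinarith [mul_nonneg (sq_nonneg b) ht.le])
  linarith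

lemma timeWeight_nonneg {b t : ℝ} (hb : 0 ≤ b) (ht : 0 < t) : 0 ≤ timeWeight b t := by
  have := one_sub_exp_nonneg (b := b) ht
  unfold timeWeight
  positivity

lemma timeWeight_mul_min_le {b t δ : ℝ} (hb : 0 < b) (ht : 0 < t) (hδ0 : 0 < δ)
    (hδ : δ ≤ 1 / 2) :
    timeWeight b t * min 1 t⁻¹ ≤
      b ^ 2 * (t ^ (δ + 1 / 2 - 1) * Real.exp (-(b ^ 2 * t))) +
        2 * b * (t ^ (δ - 1) * Real.exp (-(b ^ 2 * t))) +
          b ^ (1 - 2 * δ) * (t ^ (-δ) * min 1 t⁻¹) := by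
  have hmin : 0 ≤ min 1 t⁻¹ := by positivity
  have e1 : min 1 t⁻¹ ≤ t ^ (δ + 1 / 2 - 1) := by
    have := min_one_inv_le_rpow (θ := 1 / 2 - δ) ht (by linarith) (by linarith)
    convert this using 2; ring
  have e2 : min 1 t⁻¹ ≤ t ^ (δ - 1) := by
    have := min_one_inv_le_rpow (θ := 1 - δ) ht (by linarith) (by linarith)
    convert this using 2; ring
  have e3 : (√t)⁻¹ * min 1 t⁻¹ ≤ t ^ (δ - 1) := by
    calc (√t)⁻¹ * min 1 t⁻¹ ≤ t ^ (-(1 / 2) : ℝ) * t ^ (δ + 1 / 2 - 1) := by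
          rw [inv_sqrt_eq_rpow t ht.le]; gcongr
      _ = t ^ (δ - 1) := by rw [← Real.rpow_add ht]; congr 1; ring
  have e4 : (1 - Real.exp (-(b ^ 2 * t))) * (√t)⁻¹ ≤ b ^ (1 - 2 * δ) * t ^ (-δ) := by
    have := one_sub_exp_neg_le_rpow (y := b ^ 2 * t) (θ := 1 / 2 - δ) (by positivity)
      (by linarith) (by linarith)
    calc (1 - Real.exp (-(b ^ 2 * t))) * (√t)⁻¹
        ≤ (b ^ 2 * t) ^ (1 / 2 - δ) * t ^ (-(1 / 2) : ℝ) := by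
          rw [inv_sqrt_eq_rpow t ht.le]; gcongr
      _ = b ^ (1 - 2 * δ) * t ^ (-δ) := by
          rw [Real.mul_rpow (by positivity) ht.le, mul_assoc, ← Real.rpow_add ht,
            ← Real.rpow_natCast b 2, ← Real.rpow_mul hb.le]
          congr 2 <;> push_cast <;> ring
  have hE := Real.exp_pos (-(b ^ 2 * t))
  calc timeWeight b t * min 1 t⁻¹
      = b ^ 2 * (min 1 t⁻¹ * Real.exp (-(b ^ 2 * t))) +
        (b * (min 1 t⁻¹ * Real.exp (-(b ^ 2 * t))) +
          b * ((√t)⁻¹ * min 1 t⁻¹ * Real.exp (-(b ^ 2 * t)))) +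
        ((1 - Real.exp (-(b ^ 2 * t))) * (√t)⁻¹) * min 1 t⁻¹ := by
        unfold timeWeight; ring
    _ ≤ b ^ 2 * (t ^ (δ + 1 / 2 - 1) * Real.exp (-(b ^ 2 * t))) +
        (b * (t ^ (δ - 1) * Real.exp (-(b ^ 2 * t))) +
          b * (t ^ (δ - 1) * Real.exp (-(b ^ 2 * t)))) +
        (b ^ (1 - 2 * δ) * t ^ (-δ)) * min 1 t⁻¹ := by gcongr
    _ = _ := by ring

lemma integrableOn_rpow_mul_exp_neg {a r : ℝ} (ha : 0 < a) (hr : 0 < r) :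
    IntegrableOn (fun t : ℝ => t ^ (a - 1) * Real.exp (-(r * t))) (Ioi 0) := by
  have := integrableOn_rpow_mul_exp_neg_mul_rpow (p := 1) (s := a - 1) (b := r) (by linarith)
    one_pos hr
  simpa [neg_mul] using this

lemma lintegral_rpow_mul_exp_neg {a b : ℝ} (ha : 0 < a) (hb : 0 < b) :
    ∫⁻ t in Ioi (0 : ℝ), ENNReal.ofReal (t ^ (a - 1) * Real.exp (-(b ^ 2 * t))) =
      ENNReal.ofReal (b ^ (-(2 * a)) * Real.Gamma a) := by
  have hb2 : 0 < b ^ 2 := by positivity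
  rw [← ofReal_integral_eq_lintegral_ofReal (integrableOn_rpow_mul_exp_neg ha hb2),
    integral_rpow_mul_exp_neg_mul_Ioi ha hb2]
  · congr 2
    rw [one_div, Real.inv_rpow hb2.le, ← Real.rpow_natCast b 2, ← Real.rpow_mul hb.le,
      ← Real.rpow_neg hb.le]
    norm_num
  · filter_upwards [ae_restrict_mem measurableSet_Ioi] with t ht
    have : (0 : ℝ) < t := ht
    simp only [Pi.zero_apply]; positivity

lemma integrableOn_rpow_mul_min {δ : ℝ} (hδ0 : 0 < δ) (hδ : δ ≤ 1 / 2) :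
    IntegrableOn (fun t : ℝ => t ^ (-δ) * min 1 t⁻¹) (Ioi 0) := by
  have hmeas : Measurable (fun t : ℝ => t ^ (-δ) * min 1 t⁻¹) := by fun_prop
  rw [← Ioc_union_Ioi_eq_Ioi (zero_le_one : (0 : ℝ) ≤ 1)]
  refine IntegrableOn.union ?_ ?_
  · have h : IntegrableOn (fun t : ℝ => t ^ (-δ)) (Ioc 0 1) :=
      (intervalIntegrable_iff_integrableOn_Ioc_of_le zero_le_one).1
        (intervalIntegral.intervalIntegrable_rpow' (by linarith))
    refine h.mono' hmeas.aestronglyMeasurable ?_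
    filter_upwards [ae_restrict_mem measurableSet_Ioc] with t ht
    have h0 : 0 < t := ht.1
    rw [Real.norm_of_nonneg (by positivity)]
    exact mul_le_of_le_one_right (by positivity) (min_le_left _ _)
  · have h := integrableOn_Ioi_rpow_of_lt (a := -δ - 1) (by linarith) (one_pos)
    refine h.mono' hmeas.aestronglyMeasurable ?_
    filter_upwards [ae_restrict_mem measurableSet_Ioi] with t ht
    have h0 : 0 < t := one_pos.trans ht
    rw [Real.norm_of_nonneg (by positivity), sub_eq_add_neg, Real.rpow_add h0, Real.rpow_neg_one]
    gcongr
    exact min_le_right _ _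

lemma exists_lintegral_timeWeight_le {δ : ℝ} (hδ0 : 0 < δ) (hδ : δ ≤ 1 / 2) :
    ∃ C : ℝ, 0 < C ∧ ∀ b : ℝ, 0 ≤ b →
      ∫⁻ t in Ioi (0 : ℝ), ENNReal.ofReal (timeWeight b t * min 1 t⁻¹) ≤
        ENNReal.ofReal (C * b ^ (1 - 2 * δ)) := by
  set I : ℝ := ∫ t in Ioi (0 : ℝ), t ^ (-δ) * min 1 t⁻¹ with hI
  have hI0 : 0 ≤ I := by
    refine setIntegral_nonneg measurableSet_Ioi fun t ht => ?_
    have : (0 : ℝ) < t := ht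
    positivity
  have hG1 : 0 < Real.Gamma (δ + 1 / 2) := Real.Gamma_pos_of_pos (by linarith)
  have hG2 : 0 < Real.Gamma δ := Real.Gamma_pos_of_pos hδ0
  refine ⟨Real.Gamma (δ + 1 / 2) + 2 * Real.Gamma δ + I, by positivity, fun b hb => ?_⟩
  rcases hb.eq_or_lt with rfl | hb
  · simp [timeWeight]
  calc ∫⁻ t in Ioi (0 : ℝ), ENNReal.ofReal (timeWeight b t * min 1 t⁻¹)
      ≤ ∫⁻ t in Ioi (0 : ℝ),
        (ENNReal.ofReal (b ^ 2) * ENNReal.ofReal (t ^ (δ + 1 / 2 - 1) * Real.exp (-(b ^ 2 * t))) +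
        ENNReal.ofReal (2 * b) * ENNReal.ofReal (t ^ (δ - 1) * Real.exp (-(b ^ 2 * t))) +
        ENNReal.ofReal (b ^ (1 - 2 * δ)) * ENNReal.ofReal (t ^ (-δ) * min 1 t⁻¹)) := by
        refine setLIntegral_mono' measurableSet_Ioi fun t ht => ?_
        have h0 : (0 : ℝ) < t := ht
        rw [← ENNReal.ofReal_mul (by positivity), ← ENNReal.ofReal_mul (by positivity),
          ← ENNReal.ofReal_mul (by positivity), ← ENNReal.ofReal_add (by positivity)
          (by positivity), ← ENNReal.ofReal_add (by positivity) (by positivity)]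
        exact ENNReal.ofReal_le_ofReal (timeWeight_mul_min_le hb h0 hδ0 hδ)
    _ = ENNReal.ofReal (b ^ 2) * ENNReal.ofReal (b ^ (-(2 * (δ + 1 / 2))) * Real.Gamma (δ + 1 / 2))
        + ENNReal.ofReal (2 * b) * ENNReal.ofReal (b ^ (-(2 * δ)) * Real.Gamma δ)
        + ENNReal.ofReal (b ^ (1 - 2 * δ)) * ENNReal.ofReal I := by
        rw [lintegral_add_left (by fun_prop), lintegral_add_left (by fun_prop),
          lintegral_const_mul _ (by fun_prop), lintegral_const_mul _ (by fun_prop),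
          lintegral_const_mul _ (by fun_prop), lintegral_rpow_mul_exp_neg (by linarith) hb,
          lintegral_rpow_mul_exp_neg hδ0 hb, hI,
          ofReal_integral_eq_lintegral_ofReal (integrableOn_rpow_mul_min hδ0 hδ)]
        filter_upwards [ae_restrict_mem measurableSet_Ioi] with t ht
        have : (0 : ℝ) < t := ht
        simp only [Pi.zero_apply]; positivity
    _ = ENNReal.ofReal ((Real.Gamma (δ + 1 / 2) + 2 * Real.Gamma δ + I) * b ^ (1 - 2 * δ)) := by
        rw [← ENNReal.ofReal_mul (by positivity), ← ENNReal.ofReal_mul (by positivity),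
          ← ENNReal.ofReal_mul (by positivity), ← ENNReal.ofReal_add (by positivity)
          (by positivity), ← ENNReal.ofReal_add (by positivity) (by positivity)]
        congr 1
        have h1 : b ^ 2 * b ^ (-(2 * (δ + 1 / 2))) = b ^ (1 - 2 * δ) := by
          rw [← Real.rpow_natCast b 2, ← Real.rpow_add hb]; congr 1; push_cast; ring
        have h2 : b * b ^ (-(2 * δ)) = b ^ (1 - 2 * δ) := by
          nth_rewrite 1 [← Real.rpow_one b]
          rw [← Real.rpow_add hb]; congr 1
        linear_combination Real.Gamma (δ + 1 / 2) * h1 + 2 * Real.Gamma δ * h2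

lemma lintegral_mul_sq_le {α : Type*} [MeasurableSpace α] (μ : Measure α) {u v : α → ℝ≥0∞}
    (hu : AEMeasurable u μ) (hv : AEMeasurable v μ) :
    (∫⁻ x, u x * v x ∂μ) ^ 2 ≤ (∫⁻ x, u x ^ 2 ∂μ) * ∫⁻ x, v x ^ 2 ∂μ := by
  have h := ENNReal.lintegral_mul_le_Lp_mul_Lq μ Real.HolderConjugate.two_two hu hv
  calc (∫⁻ x, u x * v x ∂μ) ^ 2
      ≤ ((∫⁻ a, u a ^ (2 : ℝ) ∂μ) ^ (1 / 2 : ℝ) * (∫⁻ a, v a ^ (2 : ℝ) ∂μ) ^ (1 / 2 : ℝ)) ^ 2 := by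
        gcongr; exact h
    _ = _ := by
        rw [mul_pow, ← ENNReal.rpow_natCast, ← ENNReal.rpow_natCast, ← ENNReal.rpow_mul,
          ← ENNReal.rpow_mul]
        norm_num

lemma lintegral_conv_sq_le {k f : R2 → ℝ≥0∞} (hk : Measurable k) (hf : Measurable f) :
    ∫⁻ ξ : R2, (∫⁻ η : R2, k (ξ - η) * f η) ^ 2 ≤ (∫⁻ x, k x) ^ 2 * ∫⁻ η, f η ^ 2 := by
  have hhalf : ∀ y : ℝ≥0∞, (y ^ (1 / 2 : ℝ)) ^ 2 = y := fun y => by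
    rw [← ENNReal.rpow_natCast, ← ENNReal.rpow_mul]; norm_num
  calc ∫⁻ ξ : R2, (∫⁻ η : R2, k (ξ - η) * f η) ^ 2
      ≤ ∫⁻ ξ : R2, (∫⁻ x, k x) * ∫⁻ η : R2, k (ξ - η) * f η ^ 2 := by
        refine lintegral_mono fun ξ => ?_
        have h := lintegral_mul_sq_le volume (u := fun η => k (ξ - η) ^ (1 / 2 : ℝ))
          (v := fun η => k (ξ - η) ^ (1 / 2 : ℝ) * f η) (by fun_prop) (by fun_prop)
        simp only [mul_pow, hhalf, ← mul_assoc, ← sq] at h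
        rwa [lintegral_sub_left_eq_self k ξ] at h
    _ = (∫⁻ x, k x) * ∫⁻ ξ : R2, ∫⁻ η : R2, k (ξ - η) * f η ^ 2 :=
        lintegral_const_mul _ (Measurable.lintegral_prod_right (by fun_prop))
    _ = (∫⁻ x, k x) * ∫⁻ η : R2, ∫⁻ ξ : R2, k (ξ - η) * f η ^ 2 := by
        rw [lintegral_lintegral_swap (by fun_prop)]
    _ = (∫⁻ x, k x) ^ 2 * ∫⁻ η, f η ^ 2 := by
        have h : ∀ η : R2, ∫⁻ ξ : R2, k (ξ - η) * f η ^ 2 = (∫⁻ x, k x) * f η ^ 2 := fun η => by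
          rw [lintegral_mul_const _ (by fun_prop), lintegral_sub_right_eq_self k η]
        simp_rw [h]
        rw [lintegral_const_mul _ (by fun_prop), sq, mul_assoc]

/-- The lower integral of an arbitrary square-integrable function against measurable kernels is
controlled by a measurable function of no larger norm. -/
lemma exists_measurable_minorant {α : Type*} [MeasurableSpace α] (μ : Measure α) (F : α → ℝ≥0∞)
    (hF : ∫⁻ x, F x ^ 2 ∂μ ≠ ∞) :
    ∃ f : α → ℝ≥0∞, Measurable f ∧ ∫⁻ x, f x ^ 2 ∂μ = ∫⁻ x, F x ^ 2 ∂μ ∧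
      ∀ k : α → ℝ≥0∞, Measurable k → (∀ᵐ x ∂μ, k x ≠ ∞) →
        ∫⁻ x, k x * F x ∂μ ≤ ∫⁻ x, k x * f x ∂μ := by
  obtain ⟨g, hgm, hg, hgi⟩ := exists_measurable_le_lintegral_eq μ (fun x => F x ^ 2)
  have hhalf : ∀ y : ℝ≥0∞, (y ^ (1 / 2 : ℝ)) ^ 2 = y := fun y => by
    rw [← ENNReal.rpow_natCast, ← ENNReal.rpow_mul]; norm_num
  refine ⟨fun x => g x ^ (1 / 2 : ℝ), by fun_prop, by simp only [hhalf, hgi], fun k hk hkt => ?_⟩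
  obtain ⟨s, hsm, hs, hsi⟩ := exists_measurable_le_lintegral_eq μ (fun x => k x * F x)
  rw [hsi]
  have hq : ∀ x, s x / k x ≤ F x := fun x =>
    ENNReal.div_le_of_le_mul (by rw [mul_comm]; exact hs x)
  have hmax : ∫⁻ x, max (g x) ((s x / k x) ^ 2) ∂μ ≤ ∫⁻ x, g x ∂μ := by
    rw [← hgi]
    exact lintegral_mono fun x => max_le (hg x) (pow_le_pow_left' (hq x) 2)
  have hae : g =ᵐ[μ] fun x => max (g x) ((s x / k x) ^ 2) :=
    ae_eq_of_ae_le_of_lintegral_le (Filter.Eventually.of_forall fun x => le_max_left _ _)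
      (by rw [← hgi]; exact hF) (by fun_prop) hmax
  refine lintegral_mono_ae ?_
  filter_upwards [hae, hkt] with x hx hkx
  have h1 : (s x / k x) ^ 2 ≤ (g x ^ (1 / 2 : ℝ)) ^ 2 := by
    rw [hhalf, hx]; exact le_max_right _ _
  have h2 : s x / k x ≤ g x ^ (1 / 2 : ℝ) := (ENNReal.pow_le_pow_left_iff two_ne_zero).1 h1
  rcases eq_or_ne (k x) 0 with h0 | h0
  · have := hs x
    simp only [h0, zero_mul] at this
    exact this.trans zero_le
  · calc s x = k x * (s x / k x) := (ENNReal.mul_div_cancel h0 hkx).symm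
      _ ≤ _ := by gcongr

/-- The common majorant of the absolute values of all kernels in `Z`. -/
def heatMajorant (b : ℝ) (x : R2) : ℝ≥0∞ :=
  ∫⁻ t in Ioi (0 : ℝ), ENNReal.ofReal (timeWeight b t * (t⁻¹ * Real.exp (-‖x‖ ^ 2 / (8 * t))))

/-- The contribution of times `t ≤ 1` to `heatMajorant`. -/
def heatMajorantNear (b : ℝ) (x : R2) : ℝ≥0∞ :=
  ∫⁻ t in Ioc (0 : ℝ) 1, ENNReal.ofReal (timeWeight b t * (t⁻¹ * Real.exp (-‖x‖ ^ 2 / (8 * t))))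

/-- The total mass of `timeWeight b` against `min 1 t⁻¹`. -/
def timeMass (b : ℝ) : ℝ≥0∞ :=
  ∫⁻ t in Ioi (0 : ℝ), ENNReal.ofReal (timeWeight b t * min 1 t⁻¹)

lemma measurable_heatIntegrand (b : ℝ) : Measurable (fun p : R2 × ℝ =>
    ENNReal.ofReal (timeWeight b p.2 * (p.2⁻¹ * Real.exp (-‖p.1‖ ^ 2 / (8 * p.2))))) := by
  have := measurable_timeWeight b
  fun_prop

lemma measurable_heatMajorant (b : ℝ) : Measurable (heatMajorant b) :=
  (measurable_heatIntegrand b).lintegral_prod_right'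

lemma measurable_heatMajorantNear (b : ℝ) : Measurable (heatMajorantNear b) :=
  (measurable_heatIntegrand b).lintegral_prod_right'

lemma heatMajorant_le {b : ℝ} (hb : 0 ≤ b) (x : R2) :
    heatMajorant b x ≤ heatMajorantNear b x + timeMass b := by
  unfold heatMajorant heatMajorantNear timeMass
  have hd : Disjoint (Ioc (0 : ℝ) 1) (Ioi 1) := Ioc_disjoint_Ioi_same
  rw [← Ioc_union_Ioi_eq_Ioi (zero_le_one : (0 : ℝ) ≤ 1), lintegral_union measurableSet_Ioi hd]
  refine add_le_add le_rfl ?_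
  refine (setLIntegral_mono' measurableSet_Ioi fun t ht => ?_).trans
    (lintegral_mono_set (subset_union_right (s := Ioc (0 : ℝ) 1)))
  have h1 : (1 : ℝ) < t := ht
  have h0 : 0 < t := one_pos.trans h1
  have hw := timeWeight_nonneg hb h0
  refine ENNReal.ofReal_le_ofReal (mul_le_mul_of_nonneg_left ?_ hw)
  rw [min_eq_right (inv_le_one_of_one_le₀ h1.le)]
  refine mul_le_of_le_one_right (by positivity) (Real.exp_le_one_iff.2 ?_)
  rw [neg_div]
  have : 0 ≤ ‖x‖ ^ 2 / (8 * t) := by positivity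
  linarith

lemma integrable_gaussian_R2 {c : ℝ} (hc : 0 < c) :
    Integrable (fun x : R2 => Real.exp (-c * ‖x‖ ^ 2)) := by
  by_contra h
  have h1 := GaussianFourier.integral_rexp_neg_mul_sq_norm (V := R2) hc
  rw [integral_undef h] at h1
  have : 0 < (π / c) ^ ((Module.finrank ℝ R2 : ℝ) / 2) := by positivity
  linarith

lemma lintegral_gaussian_R2 {c : ℝ} (hc : 0 < c) :
    ∫⁻ x : R2, ENNReal.ofReal (Real.exp (-c * ‖x‖ ^ 2)) = ENNReal.ofReal (π / c) := by
  rw [← ofReal_integral_eq_lintegral_ofReal (integrable_gaussian_R2 hc)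
    (Filter.Eventually.of_forall fun x => (Real.exp_pos _).le),
    GaussianFourier.integral_rexp_neg_mul_sq_norm hc]
  simp

lemma lintegral_heatMajorantNear_le {b : ℝ} (hb : 0 ≤ b) :
    ∫⁻ x, heatMajorantNear b x ≤ ENNReal.ofReal (8 * π) * timeMass b := by
  unfold heatMajorantNear timeMass
  rw [lintegral_lintegral_swap (measurable_heatIntegrand b).aemeasurable,
    ← lintegral_const_mul _ (by have := measurable_timeWeight b; fun_prop)]
  refine (setLIntegral_mono' measurableSet_Ioc fun t ht => ?_).trans
    (lintegral_mono_set Ioc_subset_Ioi_self)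
  have h0 : 0 < t := ht.1
  have hw := timeWeight_nonneg hb h0
  rw [min_eq_left ((one_le_inv₀ h0).2 ht.2)]
  have hc : 0 < (8 * t)⁻¹ := by positivity
  calc ∫⁻ x : R2, ENNReal.ofReal (timeWeight b t * (t⁻¹ * Real.exp (-‖x‖ ^ 2 / (8 * t))))
      = ∫⁻ x : R2, ENNReal.ofReal (timeWeight b t * t⁻¹) *
          ENNReal.ofReal (Real.exp (-(8 * t)⁻¹ * ‖x‖ ^ 2)) := by
        refine lintegral_congr fun x => ?_
        rw [← ENNReal.ofReal_mul (by positivity)]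
        congr 1
        rw [mul_assoc]; congr 3; ring
    _ = ENNReal.ofReal (8 * π) * ENNReal.ofReal (timeWeight b t * 1) := by
        rw [lintegral_const_mul _ (by fun_prop), lintegral_gaussian_R2 hc,
          ← ENNReal.ofReal_mul (by positivity), ← ENNReal.ofReal_mul (by positivity)]
        congr 1
        field_simp
    _ ≤ _ := le_rfl

lemma heatMajorant_ae_ne_top {b : ℝ} (hb : 0 ≤ b) (hM : timeMass b ≠ ∞) :
    ∀ᵐ x, heatMajorant b x ≠ ∞ := by
  have h : ∫⁻ x, heatMajorantNear b x ≠ ∞ :=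
    ((lintegral_heatMajorantNear_le hb).trans_lt
      (ENNReal.mul_lt_top ENNReal.ofReal_lt_top hM.lt_top)).ne
  filter_upwards [ae_lt_top (measurable_heatMajorantNear b) h] with x hx
  exact ((heatMajorant_le hb x).trans_lt (ENNReal.add_lt_top.2 ⟨hx, hM.lt_top⟩)).ne

/-- The weight of `L²_ξ(m)`. -/
def weight (m : ℝ) (ξ : R2) : ℝ := (1 + ‖ξ‖ ^ 2) ^ (m / 2)

lemma weight_pos (m : ℝ) (ξ : R2) : 0 < weight m ξ := by unfold weight; positivity

lemma one_le_weight {m : ℝ} (hm : 0 ≤ m) (ξ : R2) : 1 ≤ weight m ξ :=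
  Real.one_le_rpow (by nlinarith [sq_nonneg ‖ξ‖]) (by linarith)

lemma measurable_weight (m : ℝ) : Measurable (weight m) := by unfold weight; fun_prop

lemma lintegral_inv_weight_sq_ne_top {m : ℝ} (hm : 1 < m) :
    ∫⁻ ξ : R2, ENNReal.ofReal ((weight m ξ)⁻¹) ^ 2 ≠ ∞ := by
  have h := integrable_rpow_neg_one_add_norm_sq (E := R2) (μ := volume) (r := 2 * m)
    (by simp; linarith)
  have h2 := h.lintegral_lt_top
  convert h2.ne using 3 with ξ
  rw [← ENNReal.ofReal_pow (inv_nonneg.2 (weight_pos m ξ).le)]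
  congr 1
  unfold weight
  rw [← Real.rpow_neg (by positivity), ← Real.rpow_natCast, ← Real.rpow_mul (by positivity)]
  congr 1; push_cast; ring

lemma ennreal_add_sq_le (a b : ℝ≥0∞) : (a + b) ^ 2 ≤ 4 * (a ^ 2 + b ^ 2) := by
  calc (a + b) ^ 2 ≤ (2 * max a b) ^ 2 := by
        gcongr; rw [two_mul]; gcongr <;> simp
    _ = 4 * (max a b) ^ 2 := by rw [mul_pow]; norm_num
    _ ≤ _ := by
        gcongr
        rcases le_total a b with h | h <;> simp [h]

lemma exists_lintegral_heatMajorant_conv_le {m : ℝ} (hm : 1 < m) :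
    ∃ K : ℝ≥0∞, K ≠ ∞ ∧ ∀ (b : ℝ) (f : R2 → ℝ≥0∞), 0 ≤ b → Measurable f →
      ∫⁻ ξ : R2, (ENNReal.ofReal (Real.exp (-‖ξ‖ ^ 2 / 8)) *
          ∫⁻ η : R2, heatMajorant b (ξ - η) * f η) ^ 2 ≤
        K * timeMass b ^ 2 * ∫⁻ η : R2, (ENNReal.ofReal (weight m η) * f η) ^ 2 := by
  set J : ℝ≥0∞ := ∫⁻ ξ : R2, ENNReal.ofReal ((weight m ξ)⁻¹) ^ 2 with hJ
  have hJt : J ≠ ∞ := lintegral_inv_weight_sq_ne_top hm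
  set L : ℝ≥0∞ := ∫⁻ ξ : R2, ENNReal.ofReal (Real.exp (-‖ξ‖ ^ 2 / 8)) ^ 2 with hL
  have hLt : L ≠ ∞ := by
    have : L = ENNReal.ofReal (π / 4⁻¹) := by
      rw [hL, ← lintegral_gaussian_R2 (by norm_num)]
      refine lintegral_congr fun ξ => ?_
      rw [← ENNReal.ofReal_pow (Real.exp_pos _).le, ← Real.exp_nat_mul]
      congr 2; push_cast; ring
    rw [this]; exact ENNReal.ofReal_ne_top
  refine ⟨4 * (ENNReal.ofReal (8 * π) ^ 2 + L * J), ?_, fun b f hb hf => ?_⟩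
  · have := ENNReal.ofReal_ne_top (r := 8 * π)
    finiteness
  set N : ℝ≥0∞ := ∫⁻ η : R2, (ENNReal.ofReal (weight m η) * f η) ^ 2 with hN
  have hwm := measurable_weight m
  have hnm := measurable_heatMajorantNear b
  have hfN : ∫⁻ η, f η ^ 2 ≤ N := by
    refine lintegral_mono fun η => pow_le_pow_left' ?_ 2
    refine le_mul_of_one_le_left' ?_
    exact ENNReal.one_le_ofReal.2 (one_le_weight (by linarith) η)
  have hf1 : (∫⁻ η, f η) ^ 2 ≤ J * N := by
    have h := lintegral_mul_sq_le volume (u := fun η => ENNReal.ofReal ((weight m η)⁻¹))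
      (v := fun η => ENNReal.ofReal (weight m η) * f η) (by fun_prop) (by fun_prop)
    convert h using 4 with η
    rw [← mul_assoc, ← ENNReal.ofReal_mul (inv_nonneg.2 (weight_pos m η).le),
      inv_mul_cancel₀ (weight_pos m η).ne', ENNReal.ofReal_one, one_mul]
  have hpt : ∀ ξ : R2, (ENNReal.ofReal (Real.exp (-‖ξ‖ ^ 2 / 8)) *
      ∫⁻ η : R2, heatMajorant b (ξ - η) * f η) ^ 2 ≤
      4 * ((∫⁻ η : R2, heatMajorantNear b (ξ - η) * f η) ^ 2 +
        ENNReal.ofReal (Real.exp (-‖ξ‖ ^ 2 / 8)) ^ 2 * (timeMass b * ∫⁻ η, f η) ^ 2) := by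
    intro ξ
    have he : ENNReal.ofReal (Real.exp (-‖ξ‖ ^ 2 / 8)) ≤ 1 := by
      refine ENNReal.ofReal_le_one.2 (Real.exp_le_one_iff.2 ?_)
      have := sq_nonneg ‖ξ‖
      linarith
    have h1 : ∫⁻ η : R2, heatMajorant b (ξ - η) * f η ≤
        (∫⁻ η : R2, heatMajorantNear b (ξ - η) * f η) + timeMass b * ∫⁻ η, f η := by
      rw [← lintegral_const_mul _ hf, ← lintegral_add_left (by fun_prop)]
      refine lintegral_mono fun η => ?_
      simp only
      rw [← add_mul]
      gcongr
      exact heatMajorant_le hb _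
    calc _ ≤ ((∫⁻ η : R2, heatMajorantNear b (ξ - η) * f η) +
          ENNReal.ofReal (Real.exp (-‖ξ‖ ^ 2 / 8)) * (timeMass b * ∫⁻ η, f η)) ^ 2 := by
          gcongr
          refine (mul_le_mul_right h1 _).trans ?_
          rw [mul_add]
          gcongr
          exact mul_le_of_le_one_left' he
      _ ≤ _ := by
          rw [← mul_pow]
          exact ennreal_add_sq_le _ _
  calc _ ≤ ∫⁻ ξ : R2, 4 * ((∫⁻ η : R2, heatMajorantNear b (ξ - η) * f η) ^ 2 +
        ENNReal.ofReal (Real.exp (-‖ξ‖ ^ 2 / 8)) ^ 2 * (timeMass b * ∫⁻ η, f η) ^ 2) :=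
        lintegral_mono hpt
    _ = 4 * ((∫⁻ ξ : R2, (∫⁻ η : R2, heatMajorantNear b (ξ - η) * f η) ^ 2) +
        L * (timeMass b * ∫⁻ η, f η) ^ 2) := by
        rw [lintegral_const_mul' _ _ (by norm_num), lintegral_add_right _ (by fun_prop),
          lintegral_mul_const _ (by fun_prop)]
    _ ≤ 4 * ((ENNReal.ofReal (8 * π) * timeMass b) ^ 2 * N + L * (timeMass b ^ 2 * (J * N))) := by
        gcongr
        · refine (lintegral_conv_sq_le hnm hf).trans ?_
          gcongr
          exact lintegral_heatMajorantNear_le hb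
        · rw [mul_pow]; gcongr
    _ = _ := by ring

/-- The weighted estimate for arbitrary, possibly non-measurable, densities. -/
lemma exists_lintegral_heatMajorant_conv_le' {m : ℝ} (hm : 1 < m) :
    ∃ K : ℝ≥0∞, K ≠ ∞ ∧ ∀ (b : ℝ) (F : R2 → ℝ≥0∞), 0 ≤ b → timeMass b ≠ ∞ →
      ∫⁻ η : R2, (ENNReal.ofReal (weight m η) * F η) ^ 2 ≠ ∞ →
      ∫⁻ ξ : R2, (ENNReal.ofReal (Real.exp (-‖ξ‖ ^ 2 / 8)) *
          ∫⁻ η : R2, heatMajorant b (ξ - η) * F η) ^ 2 ≤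
        K * timeMass b ^ 2 * ∫⁻ η : R2, (ENNReal.ofReal (weight m η) * F η) ^ 2 := by
  obtain ⟨K, hK, h⟩ := exists_lintegral_heatMajorant_conv_le hm
  refine ⟨K, hK, fun b F hb hM hF => ?_⟩
  obtain ⟨f, hfm, hfi, hf⟩ := exists_measurable_minorant volume _ hF
  have hwm := measurable_weight m
  have hHm := measurable_heatMajorant b
  have hcancel : ∀ η : R2, ENNReal.ofReal ((weight m η)⁻¹) * ENNReal.ofReal (weight m η) = 1 :=
    fun η => by
      rw [← ENNReal.ofReal_mul (inv_nonneg.2 (weight_pos m η).le),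
        inv_mul_cancel₀ (weight_pos m η).ne', ENNReal.ofReal_one]
  have h1 := h b (fun η => ENNReal.ofReal ((weight m η)⁻¹) * f η) hb (by fun_prop)
  simp only [← mul_assoc, mul_comm (ENNReal.ofReal (weight m _)) (ENNReal.ofReal _⁻¹), hcancel,
    one_mul, hfi] at h1
  refine le_trans (lintegral_mono fun ξ => ?_) h1
  refine pow_le_pow_left' (mul_le_mul_right ?_ _) 2
  have hae : ∀ᵐ η : R2, heatMajorant b (ξ - η) * ENNReal.ofReal ((weight m η)⁻¹) ≠ ∞ := by
    have := (quasiMeasurePreserving_sub_left volume ξ).ae (heatMajorant_ae_ne_top hb hM)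
    filter_upwards [this] with η hη
    exact ENNReal.mul_ne_top hη ENNReal.ofReal_ne_top
  have h2 := hf _ (by fun_prop) hae
  calc ∫⁻ η : R2, heatMajorant b (ξ - η) * F η
      = ∫⁻ η : R2, heatMajorant b (ξ - η) * ENNReal.ofReal ((weight m η)⁻¹) *
          (ENNReal.ofReal (weight m η) * F η) := by
        refine lintegral_congr fun η => ?_
        rw [mul_assoc, ← mul_assoc (ENNReal.ofReal _⁻¹), hcancel, one_mul]
    _ ≤ _ := h2

lemma ofReal_mul_enorm_resKer_le {b c : ℝ} (hb : 0 ≤ b) (hc0 : 0 ≤ c) (hc : c ≤ b ^ 2 + b)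
    (x : R2) : ENNReal.ofReal c * ‖resKer (b ^ 2) x‖ₑ ≤ heatMajorant b x := by
  unfold resKer heatMajorant
  refine (mul_le_mul_right (enorm_integral_le_lintegral_enorm _) _).trans ?_
  rw [← lintegral_const_mul' _ _ ENNReal.ofReal_ne_top]
  refine setLIntegral_mono' measurableSet_Ioi fun t ht => ?_
  have h0 : (0 : ℝ) < t := ht
  rw [Real.enorm_of_nonneg (by positivity), ← ENNReal.ofReal_mul hc0]
  refine ENNReal.ofReal_le_ofReal ?_
  have hE : c * Real.exp (-(b ^ 2 * t)) ≤ timeWeight b t := by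
    have h1 := one_sub_exp_nonneg (b := b) h0
    have h2 : 0 ≤ (1 - Real.exp (-(b ^ 2 * t))) * (√t)⁻¹ := by positivity
    have h3 : c * Real.exp (-(b ^ 2 * t)) ≤
        Real.exp (-(b ^ 2 * t)) * (b ^ 2 + b + b * (√t)⁻¹) := by
      rw [mul_comm]
      have : 0 ≤ b * (√t)⁻¹ := by positivity
      gcongr
      linarith
    unfold timeWeight
    linarith
  rw [← mul_assoc]
  have hπ := Real.pi_gt_three
  have hexp : -‖x‖ ^ 2 / (4 * t) ≤ -‖x‖ ^ 2 / (8 * t) := by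
    rw [neg_div, neg_div, neg_le_neg_iff]
    gcongr
    norm_num
  have hw := timeWeight_nonneg hb h0
  gcongr
  nlinarith

lemma norm_mul_heat_grad_le (x : R2) {t : ℝ} (ht : 0 < t) :
    (4 * π * t)⁻¹ * Real.exp (-‖x‖ ^ 2 / (4 * t)) * (2 * t)⁻¹ * ‖x‖ ≤
      (√t)⁻¹ * (t⁻¹ * Real.exp (-‖x‖ ^ 2 / (8 * t))) := by
  obtain ⟨s, hs, rfl⟩ : ∃ s : ℝ, 0 < s ∧ t = s ^ 2 :=
    ⟨√t, Real.sqrt_pos.2 ht, (Real.sq_sqrt ht.le).symm⟩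
  rw [Real.sqrt_sq hs.le]
  set r := ‖x‖
  set E := Real.exp (-r ^ 2 / (8 * s ^ 2)) with hE
  have hE0 : 0 < E := Real.exp_pos _
  have h1 : Real.exp (-r ^ 2 / (4 * s ^ 2)) = E * E := by
    rw [hE, ← Real.exp_add]; congr 1; field_simp; ring
  have h2 : r * E ≤ 2 * s := by
    have h3 : 1 + r ^ 2 / (8 * s ^ 2) ≤ E⁻¹ := by
      rw [hE, ← Real.exp_neg, neg_div, neg_neg]
      linarith [Real.add_one_le_exp (r ^ 2 / (8 * s ^ 2))]
    have h4 : r ≤ 2 * s * (1 + r ^ 2 / (8 * s ^ 2)) := by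
      have : 2 * s * (1 + r ^ 2 / (8 * s ^ 2)) - r = ((r - 2 * s) ^ 2 + 4 * s ^ 2) / (4 * s) := by
        field_simp; ring
      have : 0 ≤ ((r - 2 * s) ^ 2 + 4 * s ^ 2) / (4 * s) := by positivity
      linarith
    calc r * E ≤ (2 * s * E⁻¹) * E := by gcongr; exact h4.trans (by gcongr)
      _ = 2 * s := by field_simp
  have hπ := Real.pi_gt_three
  calc (4 * π * s ^ 2)⁻¹ * Real.exp (-r ^ 2 / (4 * s ^ 2)) * (2 * s ^ 2)⁻¹ * r
      = (4 * π * s ^ 2)⁻¹ * (2 * s ^ 2)⁻¹ * E * (r * E) := by rw [h1]; ring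
    _ ≤ (4 * π * s ^ 2)⁻¹ * (2 * s ^ 2)⁻¹ * E * (2 * s) := by gcongr
    _ = (4 * π)⁻¹ * (s⁻¹ * ((s ^ 2)⁻¹ * E)) := by field_simp
    _ ≤ 1 * (s⁻¹ * ((s ^ 2)⁻¹ * E)) := by
        gcongr
        exact inv_le_one_of_one_le₀ (by linarith)
    _ = _ := one_mul _

lemma ofReal_mul_enorm_resGradScalar_le {b : ℝ} (hb : 0 ≤ b) (x : R2) :
    ENNReal.ofReal b * (‖resGradScalar (b ^ 2) x‖ₑ * ‖x‖ₑ) ≤ heatMajorant b x := by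
  unfold resGradScalar heatMajorant
  rw [mul_comm _ ‖x‖ₑ, ← mul_assoc]
  refine (mul_le_mul_right (enorm_integral_le_lintegral_enorm _) _).trans ?_
  rw [← ofReal_norm x, ← ENNReal.ofReal_mul hb,
    ← lintegral_const_mul' _ _ ENNReal.ofReal_ne_top]
  refine setLIntegral_mono' measurableSet_Ioi fun t ht => ?_
  have h0 : (0 : ℝ) < t := ht
  rw [mul_neg, enorm_neg, Real.enorm_of_nonneg (by positivity), ← ENNReal.ofReal_mul (by positivity)]
  refine ENNReal.ofReal_le_ofReal ?_
  have hE : Real.exp (-(b ^ 2 * t)) * (b * (√t)⁻¹) ≤ timeWeight b t := by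
    have h1 := one_sub_exp_nonneg (b := b) h0
    have h2 : 0 ≤ (1 - Real.exp (-(b ^ 2 * t))) * (√t)⁻¹ := by positivity
    have h3 : 0 ≤ Real.exp (-(b ^ 2 * t)) * (b ^ 2 + b) := by positivity
    unfold timeWeight
    linarith
  calc _ = Real.exp (-(b ^ 2 * t)) * b *
        ((4 * π * t)⁻¹ * Real.exp (-‖x‖ ^ 2 / (4 * t)) * (2 * t)⁻¹ * ‖x‖) := by ring
    _ ≤ Real.exp (-(b ^ 2 * t)) * b * ((√t)⁻¹ * (t⁻¹ * Real.exp (-‖x‖ ^ 2 / (8 * t)))) := by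
        gcongr ?_ * ?_
        exact norm_mul_heat_grad_le x h0
    _ = Real.exp (-(b ^ 2 * t)) * (b * (√t)⁻¹) * (t⁻¹ * Real.exp (-‖x‖ ^ 2 / (8 * t))) := by ring
    _ ≤ _ := by gcongr

lemma heat_grad_integral {x : R2} (hx : x ≠ 0) :
    IntegrableOn (fun t : ℝ => (4 * π * t)⁻¹ * Real.exp (-‖x‖ ^ 2 / (4 * t)) * (2 * t)⁻¹) (Ioi 0) ∧
      ∫ t in Ioi (0 : ℝ), (4 * π * t)⁻¹ * Real.exp (-‖x‖ ^ 2 / (4 * t)) * (2 * t)⁻¹ =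
        -newtonGradScalar x := by
  have hr : 0 < ‖x‖ := norm_pos_iff.2 hx
  set c : ℝ := ‖x‖ ^ 2 / 4 with hc
  have hc0 : 0 < c := by positivity
  set g : ℝ → ℝ := fun t => (8 * π * c)⁻¹ * expNegInvGlue (t / c) with hg
  have hpos : ∀ t : ℝ, 0 < t → g t = (8 * π * c)⁻¹ * Real.exp (-(c / t)) := fun t ht => by
    have : ¬ t / c ≤ 0 := not_le.2 (by positivity)
    simp only [hg, expNegInvGlue, this, if_false, inv_div]
  have hcont : ContinuousWithinAt g (Ici 0) 0 := by
    have : Continuous g :=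
      continuous_const.mul ((expNegInvGlue.contDiff (n := 0)).continuous.comp (by fun_prop))
    exact this.continuousWithinAt
  have hderiv : ∀ t ∈ Ioi (0 : ℝ), HasDerivAt g
      ((4 * π * t)⁻¹ * Real.exp (-‖x‖ ^ 2 / (4 * t)) * (2 * t)⁻¹) t := by
    intro t ht
    have h0 : (0 : ℝ) < t := ht
    have h1 : HasDerivAt (fun t : ℝ => (8 * π * c)⁻¹ * Real.exp (-(c * t⁻¹)))
        ((8 * π * c)⁻¹ * (Real.exp (-(c * t⁻¹)) * -(c * -(t ^ 2)⁻¹))) t :=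
      (((hasDerivAt_inv h0.ne').const_mul c).neg.exp).const_mul _
    have h2 : g =ᶠ[nhds t] fun t : ℝ => (8 * π * c)⁻¹ * Real.exp (-(c * t⁻¹)) := by
      filter_upwards [Ioi_mem_nhds h0] with s hs
      rw [hpos s hs, div_eq_mul_inv]
    refine (h1.congr_of_eventuallyEq h2).congr_deriv ?_
    have h3 : -‖x‖ ^ 2 / (4 * t) = -(c * t⁻¹) := by rw [hc]; field_simp
    rw [h3]
    field_simp
    norm_num
  have hnn : ∀ t ∈ Ioi (0 : ℝ),
      0 ≤ (4 * π * t)⁻¹ * Real.exp (-‖x‖ ^ 2 / (4 * t)) * (2 * t)⁻¹ := fun t ht => by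
    have h0 : (0 : ℝ) < t := ht
    positivity
  have hlim : Filter.Tendsto g Filter.atTop (nhds ((8 * π * c)⁻¹)) := by
    have h1 : Filter.Tendsto (fun t : ℝ => (8 * π * c)⁻¹ * Real.exp (-(c / t))) Filter.atTop
        (nhds ((8 * π * c)⁻¹ * Real.exp (-0))) :=
      ((Real.continuous_exp.tendsto _).comp
        (tendsto_const_nhds.div_atTop Filter.tendsto_id).neg).const_mul _
    rw [neg_zero, Real.exp_zero, mul_one] at h1
    refine h1.congr' ?_
    filter_upwards [Filter.eventually_gt_atTop 0] with t ht
    exact (hpos t ht).symm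
  refine ⟨integrableOn_Ioi_deriv_of_nonneg hcont hderiv hnn hlim, ?_⟩
  rw [integral_Ioi_of_hasDerivAt_of_nonneg hcont hderiv hnn hlim]
  simp only [hg, zero_div, expNegInvGlue.zero, mul_zero, sub_zero, newtonGradScalar]
  rw [Real.rpow_neg hr.le, hc]
  norm_num
  field_simp
  norm_num

lemma enorm_resGradScalar_sub_newton_le {b : ℝ} (hb : 0 ≤ b) (x : R2) :
    ‖resGradScalar (b ^ 2) x - newtonGradScalar x‖ₑ * ‖x‖ₑ ≤ heatMajorant b x := by
  rcases eq_or_ne x 0 with rfl | hx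
  · simp
  obtain ⟨hgauss, hval⟩ := heat_grad_integral hx
  have hgauss2 : IntegrableOn (fun t : ℝ => Real.exp (-(b ^ 2 * t)) *
      ((4 * π * t)⁻¹ * Real.exp (-‖x‖ ^ 2 / (4 * t)) * (2 * t)⁻¹)) (Ioi 0) := by
    refine hgauss.mono' (by fun_prop) ?_
    filter_upwards [ae_restrict_mem measurableSet_Ioi] with t ht
    have h0 : (0 : ℝ) < t := ht
    rw [Real.norm_of_nonneg (by positivity)]
    refine mul_le_of_le_one_left (by positivity) ?_
    linarith [one_sub_exp_nonneg (b := b) h0]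
  have hdiff : resGradScalar (b ^ 2) x - newtonGradScalar x =
      ∫ t in Ioi (0 : ℝ), (1 - Real.exp (-(b ^ 2 * t))) *
        ((4 * π * t)⁻¹ * Real.exp (-‖x‖ ^ 2 / (4 * t)) * (2 * t)⁻¹) := by
    rw [← neg_eq_iff_eq_neg.2 hval]
    simp only [sub_mul, one_mul]
    rw [integral_sub hgauss hgauss2, sub_neg_eq_add, add_comm, sub_eq_add_neg, ← integral_neg]
    congr 1
    unfold resGradScalar
    refine integral_congr_ae (Filter.Eventually.of_forall fun t => ?_)
    simp only; ring
  rw [hdiff, mul_comm]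
  refine (mul_le_mul_right (enorm_integral_le_lintegral_enorm _) _).trans ?_
  unfold heatMajorant
  rw [← ofReal_norm x, ← lintegral_const_mul' _ _ ENNReal.ofReal_ne_top]
  refine setLIntegral_mono' measurableSet_Ioi fun t ht => ?_
  have h0 : (0 : ℝ) < t := ht
  have h1 := one_sub_exp_nonneg (b := b) h0
  rw [Real.enorm_of_nonneg (by positivity), ← ENNReal.ofReal_mul (by positivity)]
  refine ENNReal.ofReal_le_ofReal ?_
  have hE : (1 - Real.exp (-(b ^ 2 * t))) * (√t)⁻¹ ≤ timeWeight b t :=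
    le_add_of_nonneg_left (by positivity)
  calc _ = (1 - Real.exp (-(b ^ 2 * t))) *
        ((4 * π * t)⁻¹ * Real.exp (-‖x‖ ^ 2 / (4 * t)) * (2 * t)⁻¹ * ‖x‖) := by ring
    _ ≤ (1 - Real.exp (-(b ^ 2 * t))) *
        ((√t)⁻¹ * (t⁻¹ * Real.exp (-‖x‖ ^ 2 / (8 * t)))) := by
        gcongr ?_ * ?_
        exact norm_mul_heat_grad_le x h0
    _ = (1 - Real.exp (-(b ^ 2 * t))) * (√t)⁻¹ *
        (t⁻¹ * Real.exp (-‖x‖ ^ 2 / (8 * t))) := by ring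
    _ ≤ _ := by gcongr

lemma norm_cv2_perp (x : R2) :
    ‖cv2 ((perp x 0 : ℝ) : ℂ) ((perp x 1 : ℝ) : ℂ)‖ = ‖x‖ := by
  simp [EuclideanSpace.norm_eq, cv2, perp, v2, Fin.sum_univ_two, add_comm]

lemma enorm_cv2_le (u v : ℂ) : ‖cv2 u v‖ₑ ≤ ‖u‖ₑ + ‖v‖ₑ := by
  rw [← ofReal_norm, ← ofReal_norm, ← ofReal_norm,
    ← ENNReal.ofReal_add (norm_nonneg _) (norm_nonneg _)]
  refine ENNReal.ofReal_le_ofReal ?_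
  simp only [EuclideanSpace.norm_eq, cv2, Fin.sum_univ_two]
  refine Real.sqrt_le_iff.2 ⟨by positivity, ?_⟩
  simp
  nlinarith [norm_nonneg u, norm_nonneg v, mul_nonneg (norm_nonneg u) (norm_nonneg v)]

lemma enorm_cv3_le (u v w : ℂ) : ‖cv3 u v w‖ₑ ≤ ‖u‖ₑ + ‖v‖ₑ + ‖w‖ₑ := by
  rw [← ofReal_norm, ← ofReal_norm, ← ofReal_norm, ← ofReal_norm,
    ← ENNReal.ofReal_add (norm_nonneg _) (norm_nonneg _),
    ← ENNReal.ofReal_add (by positivity) (norm_nonneg _)]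
  refine ENNReal.ofReal_le_ofReal ?_
  simp only [EuclideanSpace.norm_eq, cv3, Fin.sum_univ_three]
  refine Real.sqrt_le_iff.2 ⟨by positivity, ?_⟩
  simp
  nlinarith [norm_nonneg u, norm_nonneg v, norm_nonneg w, mul_nonneg (norm_nonneg u) (norm_nonneg v),
    mul_nonneg (norm_nonneg u) (norm_nonneg w), mul_nonneg (norm_nonneg v) (norm_nonneg w)]

lemma enorm_coord_le {n : ℕ} (v : EuclideanSpace ℂ (Fin n)) (i : Fin n) : ‖v i‖ₑ ≤ ‖v‖ₑ := by
  rw [← ofReal_norm, ← ofReal_norm]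
  exact ENNReal.ofReal_le_ofReal (PiLp.norm_apply_le v i)

lemma enorm_coord_real_le (x : R2) (i : Fin 2) : ‖((x i : ℝ) : ℂ)‖ₑ ≤ ‖x‖ₑ := by
  rw [← ofReal_norm, ← ofReal_norm, Complex.norm_real]
  exact ENNReal.ofReal_le_ofReal (PiLp.norm_apply_le x i)

lemma enorm_perp (x : R2) : ‖perp x‖ₑ = ‖x‖ₑ := by
  rw [← ofReal_norm, ← ofReal_norm]
  simp [EuclideanSpace.norm_eq, perp, v2, Fin.sum_univ_two, add_comm]

lemma enorm_ofReal_complex (r : ℝ) : ‖(r : ℂ)‖ₑ = ‖r‖ₑ := by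
  rw [← ofReal_norm, ← ofReal_norm, Complex.norm_real]

/-- The convolution of `heatMajorant b` with a nonnegative density. -/
def heatPotential (b : ℝ) (F : R2 → ℝ≥0∞) (ξ : R2) : ℝ≥0∞ :=
  ∫⁻ η : R2, heatMajorant b (ξ - η) * F η

lemma ofReal_mul_enorm_integral_le {E : Type*} [NormedAddCommGroup E] [NormedSpace ℝ E]
    {b c : ℝ} {u : R2 → E} {F : R2 → ℝ≥0∞} {ξ : R2}
    (h : ∀ η, ENNReal.ofReal c * ‖u η‖ₑ ≤ heatMajorant b (ξ - η) * F η) :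
    ENNReal.ofReal c * ‖∫ η, u η‖ₑ ≤ heatPotential b F ξ := by
  refine (mul_le_mul_right (enorm_integral_le_lintegral_enorm _) _).trans ?_
  rw [← lintegral_const_mul' _ _ ENNReal.ofReal_ne_top]
  exact lintegral_mono h

section Potentials

variable {b : ℝ} {F : R2 → ℝ≥0∞}

lemma ofReal_mul_enorm_resConv_le {c : ℝ} (hb : 0 ≤ b) (hc0 : 0 ≤ c) (hc : c ≤ b ^ 2 + b)
    {f : R2 → ℂ} (hf : ∀ η, ‖f η‖ₑ ≤ F η) (ξ : R2) :
    ENNReal.ofReal c * ‖resConv (b ^ 2) f ξ‖ₑ ≤ heatPotential b F ξ := by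
  refine ofReal_mul_enorm_integral_le fun η => ?_
  rw [enorm_mul, enorm_ofReal_complex, ← mul_assoc]
  gcongr
  · exact ofReal_mul_enorm_resKer_le hb hc0 hc _
  · exact hf η

lemma ofReal_mul_enorm_resGradPerp_le (hb : 0 ≤ b) {f : R2 → ℂ} (hf : ∀ η, ‖f η‖ₑ ≤ F η)
    (ξ : R2) : ENNReal.ofReal b * ‖resGradPerp (b ^ 2) f ξ‖ₑ ≤ heatPotential b F ξ := by
  refine ofReal_mul_enorm_integral_le fun η => ?_
  rw [enorm_smul, enorm_mul, enorm_ofReal_complex, ← ofReal_norm (cv2 _ _), norm_cv2_perp,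
    ofReal_norm]
  calc _ = ENNReal.ofReal b * (‖resGradScalar (b ^ 2) (ξ - η)‖ₑ * ‖ξ - η‖ₑ) * ‖f η‖ₑ := by ring
    _ ≤ _ := by
      gcongr
      · exact ofReal_mul_enorm_resGradScalar_le hb _
      · exact hf η

lemma enorm_resMinusNewtonGradPerp_le (hb : 0 ≤ b) {f : R2 → ℂ} (hf : ∀ η, ‖f η‖ₑ ≤ F η)
    (ξ : R2) : ‖resMinusNewtonGradPerp (b ^ 2) f ξ‖ₑ ≤ heatPotential b F ξ := by
  rw [← one_mul ‖_‖ₑ, ← ENNReal.ofReal_one]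
  refine ofReal_mul_enorm_integral_le fun η => ?_
  rw [enorm_smul, enorm_mul, enorm_ofReal_complex, ← ofReal_norm (cv2 _ _), norm_cv2_perp,
    ofReal_norm, ENNReal.ofReal_one, one_mul]
  calc _ = (‖resGradScalar (b ^ 2) (ξ - η) - newtonGradScalar (ξ - η)‖ₑ * ‖ξ - η‖ₑ) * ‖f η‖ₑ := by
        ring
    _ ≤ _ := by
      gcongr
      · exact enorm_resGradScalar_sub_newton_le hb _
      · exact hf η

lemma ofReal_mul_enorm_resGradPerpDiv_le (hb : 0 ≤ b) {w : R2 → C2}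
    (hw : ∀ η i, ‖w η i‖ₑ ≤ F η) (ξ : R2) :
    ENNReal.ofReal b * ‖resGradPerpDiv (b ^ 2) w ξ‖ₑ ≤ heatPotential b (fun η => 2 * F η) ξ := by
  refine ofReal_mul_enorm_integral_le fun η => ?_
  rw [enorm_mul, enorm_ofReal_complex]
  have h : ∀ i, ‖((perp (ξ - η) i : ℝ) : ℂ) * w η i‖ₑ ≤ ‖ξ - η‖ₑ * F η := fun i => by
    rw [enorm_mul, ← enorm_perp (ξ - η)]
    gcongr
    · exact enorm_coord_real_le _ i
    · exact hw η i
  calc _ ≤ ENNReal.ofReal b * (‖resGradScalar (b ^ 2) (ξ - η)‖ₑ *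
        (‖ξ - η‖ₑ * F η + ‖ξ - η‖ₑ * F η)) := by
        gcongr
        exact (enorm_add_le _ _).trans (add_le_add (h 0) (h 1))
    _ = ENNReal.ofReal b * (‖resGradScalar (b ^ 2) (ξ - η)‖ₑ * ‖ξ - η‖ₑ) * (2 * F η) := by ring
    _ ≤ _ := by
      gcongr
      exact ofReal_mul_enorm_resGradScalar_le hb _

lemma heatPotential_two_mul (ξ : R2) :
    heatPotential b (fun η => 2 * F η) ξ = 2 * heatPotential b F ξ := by
  unfold heatPotential
  rw [← lintegral_const_mul' _ _ (by norm_num)]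
  refine lintegral_congr fun η => ?_
  ring

end Potentials

lemma Gval_nonneg (ξ : R2) : 0 ≤ Gval ξ := by unfold Gval; positivity

lemma exp_mul_sq_eq (τ ζ : ℝ) : Real.exp τ * ζ ^ 2 = |Real.exp (τ / 2) * ζ| ^ 2 := by
  rw [sq_abs, mul_pow, ← Real.exp_nat_mul]
  congr 2; push_cast; ring

lemma enorm_Zxi_le (τ ζ : ℝ) {w1 : R2 → C2} {w2 : R2 → ℂ} {F : R2 → ℝ≥0∞}
    (h1 : ∀ η i, ‖w1 η i‖ₑ ≤ F η) (h2 : ∀ η, ‖w2 η‖ₑ ≤ F η) (ξ : R2) :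
    ‖Zxi τ ζ w1 w2 ξ‖ₑ ≤
      ENNReal.ofReal (Gval ξ) * (3 * heatPotential |Real.exp (τ / 2) * ζ| F ξ) := by
  unfold Zxi
  rw [exp_mul_sq_eq]
  set β := Real.exp (τ / 2) * ζ
  set b := |β| with hb
  have hb0 : 0 ≤ b := abs_nonneg _
  have hβ : ‖((β : ℝ) : ℂ)‖ₑ = ENNReal.ofReal b := by
    rw [enorm_ofReal_complex, ← ofReal_norm, Real.norm_eq_abs]
  have hI : ‖Complex.I‖ₑ = 1 := by rw [← ofReal_norm]; simp
  rw [enorm_smul, enorm_mul, enorm_mul, hI, one_mul, hβ, enorm_ofReal_complex,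
    Real.enorm_of_nonneg (Gval_nonneg ξ), mul_comm (ENNReal.ofReal b), mul_assoc]
  refine mul_le_mul_right ?_ _
  have hsq : b ^ 2 ≤ b ^ 2 + b := by linarith
  have e1 := ofReal_mul_enorm_resConv_le hb0 (sq_nonneg b) hsq
    (f := fun η => cv2 (-(w1 η 1)) (w1 η 0) 0) (F := F)
    (fun η => by simpa [cv2] using h1 η 1) ξ
  have e2 := ofReal_mul_enorm_resConv_le hb0 (sq_nonneg b) hsq
    (f := fun η => cv2 (-(w1 η 1)) (w1 η 0) 1) (F := F)
    (fun η => by simpa [cv2] using h1 η 0) ξ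
  have e3 := ofReal_mul_enorm_resGradPerp_le hb0 h2 ξ
  rw [ENNReal.ofReal_pow hb0] at e1 e2
  calc _ ≤ ENNReal.ofReal b * (ENNReal.ofReal b *
        ‖resConv2 (b ^ 2) (fun η => cv2 (-(w1 η 1)) (w1 η 0)) ξ‖ₑ +
          ‖resGradPerp (b ^ 2) w2 ξ‖ₑ) := by
        refine mul_le_mul_right (enorm_sub_le.trans ?_) _
        rw [enorm_smul, enorm_mul, hI, one_mul, hβ]
    _ ≤ ENNReal.ofReal b * (ENNReal.ofReal b *
        (‖resConv (b ^ 2) (fun η => cv2 (-(w1 η 1)) (w1 η 0) 0) ξ‖ₑ +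
          ‖resConv (b ^ 2) (fun η => cv2 (-(w1 η 1)) (w1 η 0) 1) ξ‖ₑ) +
          ‖resGradPerp (b ^ 2) w2 ξ‖ₑ) := by
        gcongr
        exact enorm_cv2_le _ _
    _ = ENNReal.ofReal b ^ 2 * ‖resConv (b ^ 2) (fun η => cv2 (-(w1 η 1)) (w1 η 0) 0) ξ‖ₑ +
        ENNReal.ofReal b ^ 2 * ‖resConv (b ^ 2) (fun η => cv2 (-(w1 η 1)) (w1 η 0) 1) ξ‖ₑ +
        ENNReal.ofReal b * ‖resGradPerp (b ^ 2) w2 ξ‖ₑ := by ring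
    _ ≤ heatPotential b F ξ + heatPotential b F ξ + heatPotential b F ξ := by gcongr
    _ = _ := by ring

lemma enorm_gradG_coeff_le {r : ℝ} {ξ : R2} (hr : ‖(r : ℂ)‖ₑ ≤ ‖ξ‖ₑ) :
    ‖((-r / 2 * Gval ξ : ℝ) : ℂ)‖ₑ ≤ ENNReal.ofReal ((1 + ‖ξ‖) * Gval ξ) := by
  rw [enorm_ofReal_complex, ← ofReal_norm] at hr
  rw [enorm_ofReal_complex, ← ofReal_norm, norm_mul, Real.norm_of_nonneg (Gval_nonneg ξ)]
  rw [← ofReal_norm ξ, ENNReal.ofReal_le_ofReal_iff (norm_nonneg _)] at hr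
  refine ENNReal.ofReal_le_ofReal (mul_le_mul_of_nonneg_right ?_ (Gval_nonneg ξ))
  rw [norm_div, norm_neg, Real.norm_two]
  linarith [norm_nonneg ξ]

lemma enorm_Zz_le (τ ζ : ℝ) {w1 : R2 → C2} {w2 : R2 → ℂ} {F : R2 → ℝ≥0∞}
    (h1 : ∀ η i, ‖w1 η i‖ₑ ≤ F η) (h2 : ∀ η, ‖w2 η‖ₑ ≤ F η) (ξ : R2) :
    ‖Zz τ ζ w1 w2 ξ‖ₑ ≤ ENNReal.ofReal ((1 + ‖ξ‖) * Gval ξ) *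
      (6 * heatPotential |Real.exp (τ / 2) * ζ| F ξ) := by
  unfold Zz
  rw [exp_mul_sq_eq]
  set β := Real.exp (τ / 2) * ζ
  set b := |β| with hb
  set P := heatPotential b F ξ
  set g := ENNReal.ofReal ((1 + ‖ξ‖) * Gval ξ)
  have hb0 : 0 ≤ b := abs_nonneg _
  have hβ : ‖((β : ℝ) : ℂ)‖ₑ = ENNReal.ofReal b := by
    rw [enorm_ofReal_complex, ← ofReal_norm, Real.norm_eq_abs]
  have hI : ‖Complex.I‖ₑ = 1 := by rw [← ofReal_norm]; simp
  have hG : ‖(Gval ξ : ℂ)‖ₑ ≤ g := by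
    rw [enorm_ofReal_complex, Real.enorm_of_nonneg (Gval_nonneg ξ)]
    refine ENNReal.ofReal_le_ofReal (le_mul_of_one_le_left (Gval_nonneg ξ) ?_)
    linarith [norm_nonneg ξ]
  have hp : ∀ i, ‖((-(perp ξ i) / 2 * Gval ξ : ℝ) : ℂ)‖ₑ ≤ g := fun i =>
    enorm_gradG_coeff_le (by rw [← enorm_perp ξ]; exact enorm_coord_real_le _ i)
  have hx : ∀ i, ‖((-(ξ i) / 2 * Gval ξ : ℝ) : ℂ)‖ₑ ≤ g := fun i =>
    enorm_gradG_coeff_le (enorm_coord_real_le ξ i)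
  have hle : b ≤ b ^ 2 + b := by nlinarith
  have e : ∀ i, ENNReal.ofReal b * ‖resConv2 (b ^ 2) w1 ξ i‖ₑ ≤ P := by
    intro i
    fin_cases i
    · exact ofReal_mul_enorm_resConv_le hb0 hb0 hle (fun η => h1 η 0) ξ
    · exact ofReal_mul_enorm_resConv_le hb0 hb0 hle (fun η => h1 η 1) ξ
  have e3 := ofReal_mul_enorm_resGradPerpDiv_le hb0 h1 ξ
  rw [heatPotential_two_mul] at e3
  have e4 : ∀ i, ‖resMinusNewtonGradPerp (b ^ 2) w2 ξ i‖ₑ ≤ P := fun i =>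
    (enorm_coord_le _ i).trans (enorm_resMinusNewtonGradPerp_le hb0 h2 ξ)
  refine (enorm_add_le _ _).trans ?_
  rw [enorm_mul, enorm_mul, hI, one_mul, hβ]
  calc _ ≤ ENNReal.ofReal b * (g * ‖resConv2 (b ^ 2) w1 ξ 0‖ₑ + g * ‖resConv2 (b ^ 2) w1 ξ 1‖ₑ +
          g * ‖resGradPerpDiv (b ^ 2) w1 ξ‖ₑ) + (g * P + g * P) := by
        gcongr
        · refine (enorm_add_le _ _).trans (add_le_add ((enorm_add_le _ _).trans ?_) ?_)
          · rw [enorm_mul, enorm_mul]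
            gcongr
            · exact hp 0
            · exact hp 1
          · rw [enorm_mul]; gcongr
        · refine (enorm_add_le _ _).trans ?_
          rw [enorm_mul, enorm_mul]
          gcongr
          · exact hx 0
          · exact e4 0
          · exact hx 1
          · exact e4 1
    _ = g * (ENNReal.ofReal b * ‖resConv2 (b ^ 2) w1 ξ 0‖ₑ) +
          g * (ENNReal.ofReal b * ‖resConv2 (b ^ 2) w1 ξ 1‖ₑ) +
          g * (ENNReal.ofReal b * ‖resGradPerpDiv (b ^ 2) w1 ξ‖ₑ) + (g * P + g * P) := by ring
    _ ≤ g * P + g * P + g * (2 * P) + (g * P + g * P) := by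
        gcongr
        · exact e 0
        · exact e 1
    _ = _ := by ring

lemma exists_weight_mul_Gval_le {m : ℝ} (hm : 1 < m) :
    ∃ A : ℝ, 0 ≤ A ∧ ∀ ξ : R2,
      weight m ξ * ((1 + ‖ξ‖) * Gval ξ) ≤ A * Real.exp (-‖ξ‖ ^ 2 / 8) := by
  set q : ℝ := m / 2 + 1 with hq
  have hq0 : 0 < q := by linarith
  refine ⟨2 * (8 * q) ^ q * Real.exp (1 / 8), by positivity, fun ξ => ?_⟩
  set y : ℝ := 1 + ‖ξ‖ ^ 2 with hy
  have hy0 : 0 < y := by positivity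
  have h1 : y ^ q ≤ (8 * q) ^ q * Real.exp (y / 8) := by
    have h2 : y ≤ 8 * q * Real.exp (y / (8 * q)) := by
      have := Real.add_one_le_exp (y / (8 * q))
      calc y = 8 * q * (y / (8 * q)) := by field_simp
        _ ≤ _ := by gcongr; linarith
    calc y ^ q ≤ (8 * q * Real.exp (y / (8 * q))) ^ q := by gcongr
      _ = (8 * q) ^ q * Real.exp (y / 8) := by
        rw [Real.mul_rpow (by positivity) (Real.exp_pos _).le, ← Real.exp_mul]
        congr 2; field_simp
  have h3 : 1 + ‖ξ‖ ≤ 2 * y := by nlinarith [sq_nonneg (‖ξ‖ - 1)]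
  have h4 : Real.exp (y / 8) = Real.exp (1 / 8) * Real.exp (‖ξ‖ ^ 2 / 8) := by
    rw [← Real.exp_add]; congr 1; rw [hy]; ring
  have h5 : Real.exp (‖ξ‖ ^ 2 / 8) * Real.exp (-‖ξ‖ ^ 2 / 4) = Real.exp (-‖ξ‖ ^ 2 / 8) := by
    rw [← Real.exp_add]; congr 1; ring
  have h6 : Gval ξ ≤ Real.exp (-‖ξ‖ ^ 2 / 4) := by
    refine mul_le_of_le_one_left (Real.exp_pos _).le (inv_le_one_of_one_le₀ ?_)
    linarith [Real.pi_gt_three]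
  calc weight m ξ * ((1 + ‖ξ‖) * Gval ξ)
      ≤ y ^ (m / 2) * (2 * y * Real.exp (-‖ξ‖ ^ 2 / 4)) := by
        unfold weight; gcongr; exact Gval_nonneg ξ
    _ = 2 * y ^ q * Real.exp (-‖ξ‖ ^ 2 / 4) := by
        rw [hq, Real.rpow_add hy0, Real.rpow_one]; ring
    _ ≤ 2 * ((8 * q) ^ q * Real.exp (y / 8)) * Real.exp (-‖ξ‖ ^ 2 / 4) := by gcongr
    _ = 2 * (8 * q) ^ q * Real.exp (1 / 8) *
        (Real.exp (‖ξ‖ ^ 2 / 8) * Real.exp (-‖ξ‖ ^ 2 / 4)) := by rw [h4]; ring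
    _ = _ := by rw [h5]

lemma L2mC_sq (m : ℝ) (F : R2 → C3) :
    L2mC m F ^ 2 = ∫⁻ ξ : R2, (ENNReal.ofReal (weight m ξ) * ‖F ξ‖ₑ) ^ 2 := by
  unfold L2mC
  rw [eLpNorm_eq_lintegral_rpow_enorm_toReal two_ne_zero ENNReal.ofNat_ne_top,
    ← ENNReal.rpow_natCast, ← ENNReal.rpow_mul]
  norm_num
  refine lintegral_congr fun ξ => ?_
  rw [enorm_smul, Real.enorm_of_nonneg (by positivity)]
  rfl

lemma heatMajorant_zero (x : R2) : heatMajorant 0 x = 0 := by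
  simp [heatMajorant, timeWeight]

theorem coupling_term_bound (m δ : ℝ) (hm : 1 < m) (hδ0 : 0 < δ) (hδ : δ ≤ 1/2) :
    ∃ C : ℝ, 0 < C ∧ ∀ (ζ τ : ℝ) (w1 : R2 → C2) (w2 : R2 → ℂ),
      L2mC m (fun ξ => cv3 (Zxi τ ζ w1 w2 ξ 0) (Zxi τ ζ w1 w2 ξ 1) (Zz τ ζ w1 w2 ξ)) ≤
        ENNReal.ofReal (C * |ζ| ^ (1 - 2*δ) * Real.exp ((1/2 - δ) * τ)) *
          L2mC m (fun ξ => cv3 (w1 ξ 0) (w1 ξ 1) (w2 ξ)) := by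
  obtain ⟨A, hA, hAle⟩ := exists_weight_mul_Gval_le hm
  obtain ⟨K, hK, hKle⟩ := exists_lintegral_heatMajorant_conv_le' hm
  obtain ⟨M, hM0, hMle⟩ := exists_lintegral_timeWeight_le hδ0 hδ
  refine ⟨12 * A * (1 + K.toReal) * M + 1, by positivity, fun ζ τ w1 w2 => ?_⟩
  set b := |Real.exp (τ / 2) * ζ| with hb
  have hb0 : 0 ≤ b := abs_nonneg _
  set F : R2 → ℝ≥0∞ := fun η => ‖cv3 (w1 η 0) (w1 η 1) (w2 η)‖ₑ with hF
  have h1 : ∀ η i, ‖w1 η i‖ₑ ≤ F η := fun η i => by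
    fin_cases i
    · exact enorm_coord_le (cv3 (w1 η 0) (w1 η 1) (w2 η)) 0
    · exact enorm_coord_le (cv3 (w1 η 0) (w1 η 1) (w2 η)) 1
  have h2 : ∀ η, ‖w2 η‖ₑ ≤ F η := fun η => enorm_coord_le (cv3 (w1 η 0) (w1 η 1) (w2 η)) 2
  have hpow : |ζ| ^ (1 - 2 * δ) * Real.exp ((1 / 2 - δ) * τ) = b ^ (1 - 2 * δ) := by
    rw [hb, abs_mul, abs_of_pos (Real.exp_pos _), Real.mul_rpow (Real.exp_pos _).le (abs_nonneg _),
      ← Real.exp_mul, mul_comm]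
    congr 2; ring
  rw [mul_assoc, hpow]
  set Zf : R2 → C3 := fun ξ => cv3 (Zxi τ ζ w1 w2 ξ 0) (Zxi τ ζ w1 w2 ξ 1) (Zz τ ζ w1 w2 ξ)
  set N := L2mC m (fun ξ => cv3 (w1 ξ 0) (w1 ξ 1) (w2 ξ)) with hN
  have hNsq : ∫⁻ η : R2, (ENNReal.ofReal (weight m η) * F η) ^ 2 = N ^ 2 := (L2mC_sq m _).symm
  have hZ : ∀ ξ, ENNReal.ofReal (weight m ξ) * ‖Zf ξ‖ₑ ≤
      ENNReal.ofReal (12 * A) *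
        (ENNReal.ofReal (Real.exp (-‖ξ‖ ^ 2 / 8)) * heatPotential b F ξ) := by
    intro ξ
    have hx : ENNReal.ofReal (Gval ξ) ≤ ENNReal.ofReal ((1 + ‖ξ‖) * Gval ξ) :=
      ENNReal.ofReal_le_ofReal
        (le_mul_of_one_le_left (Gval_nonneg ξ) (by linarith [norm_nonneg ξ]))
    have hxi : ∀ i, ‖Zxi τ ζ w1 w2 ξ i‖ₑ ≤
        ENNReal.ofReal ((1 + ‖ξ‖) * Gval ξ) * (3 * heatPotential b F ξ) := fun i =>
      (enorm_coord_le _ i).trans ((enorm_Zxi_le τ ζ h1 h2 ξ).trans (by gcongr))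
    calc ENNReal.ofReal (weight m ξ) * ‖Zf ξ‖ₑ
        ≤ ENNReal.ofReal (weight m ξ) *
          (ENNReal.ofReal ((1 + ‖ξ‖) * Gval ξ) * (3 * heatPotential b F ξ) +
            ENNReal.ofReal ((1 + ‖ξ‖) * Gval ξ) * (3 * heatPotential b F ξ) +
            ENNReal.ofReal ((1 + ‖ξ‖) * Gval ξ) * (6 * heatPotential b F ξ)) := by
          gcongr
          exact (enorm_cv3_le _ _ _).trans
            (add_le_add (add_le_add (hxi 0) (hxi 1)) (enorm_Zz_le τ ζ h1 h2 ξ))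
      _ = 12 * (ENNReal.ofReal (weight m ξ) * ENNReal.ofReal ((1 + ‖ξ‖) * Gval ξ)) *
            heatPotential b F ξ := by ring
      _ ≤ 12 * (ENNReal.ofReal A * ENNReal.ofReal (Real.exp (-‖ξ‖ ^ 2 / 8))) *
            heatPotential b F ξ := by
          rw [← ENNReal.ofReal_mul (weight_pos m ξ).le, ← ENNReal.ofReal_mul hA]
          exact mul_le_mul_left (mul_le_mul_right (ENNReal.ofReal_le_ofReal (hAle ξ)) _) _
      _ = _ := by
          rw [ENNReal.ofReal_mul (by norm_num : (0 : ℝ) ≤ 12)]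
          norm_num
          ring
  rw [← ENNReal.pow_le_pow_left_iff two_ne_zero, L2mC_sq, mul_pow]
  have hsq : ∫⁻ ξ : R2, (ENNReal.ofReal (weight m ξ) * ‖Zf ξ‖ₑ) ^ 2 ≤
      ENNReal.ofReal (12 * A) ^ 2 * ∫⁻ ξ : R2,
        (ENNReal.ofReal (Real.exp (-‖ξ‖ ^ 2 / 8)) * heatPotential b F ξ) ^ 2 := by
    rw [← lintegral_const_mul' _ _ (by finiteness)]
    refine lintegral_mono fun ξ => ?_
    simp only
    rw [← mul_pow]
    exact pow_le_pow_left' (hZ ξ) 2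
  refine hsq.trans ?_
  rcases hb0.eq_or_lt with hb1 | hb1
  · simp [← hb1, heatPotential, heatMajorant_zero]
  have hconst : 0 < (12 * A * (1 + K.toReal) * M + 1) * b ^ (1 - 2 * δ) := by positivity
  rcases eq_or_ne N ∞ with hNt | hNt
  · rw [hNt, ENNReal.top_pow two_ne_zero, ENNReal.mul_top]
    · exact le_top
    · exact pow_ne_zero _ (ENNReal.ofReal_pos.2 hconst).ne'
  have hmass : timeMass b ≤ ENNReal.ofReal (M * b ^ (1 - 2 * δ)) := hMle b hb0
  have hfin := hKle b F hb0 (hmass.trans_lt ENNReal.ofReal_lt_top).ne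
    (by rw [hNsq]; finiteness)
  rw [hNsq] at hfin
  have hKsq : K ≤ ENNReal.ofReal (1 + K.toReal) ^ 2 := by
    rw [← ENNReal.ofReal_pow (by positivity)]
    refine (ENNReal.le_ofReal_iff_toReal_le hK (by positivity)).2 ?_
    nlinarith [ENNReal.toReal_nonneg (a := K)]
  calc _ ≤ ENNReal.ofReal (12 * A) ^ 2 * (ENNReal.ofReal (1 + K.toReal) ^ 2 *
        ENNReal.ofReal (M * b ^ (1 - 2 * δ)) ^ 2 * N ^ 2) := by
        gcongr
        refine hfin.trans ?_
        gcongr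
    _ = ENNReal.ofReal (12 * A * (1 + K.toReal) * (M * b ^ (1 - 2 * δ))) ^ 2 * N ^ 2 := by
        rw [ENNReal.ofReal_mul (p := 12 * A * (1 + K.toReal)) (by positivity),
          ENNReal.ofReal_mul (p := 12 * A) (by positivity)]
        ring
    _ ≤ _ := by
        refine mul_le_mul_left (pow_le_pow_left' (ENNReal.ofReal_le_ofReal ?_) 2) _
        rw [← mul_assoc]
        gcongr
        linarith
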